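/- There is an absolute constant C such that for every number of agents k ≥ 2 and every time horizon T ≥ 2 there exists a deterministic allocation rule A for the stochastic MAB mechanism design problem that is monotone in expectation (for each CTR vector μ ∈ [0,1]^k, each agent i, and each fixed b_{-i}, the expected number of clicks received by agent i is a non-decreasing function of b_i) and whose regret satisfies both: worst-case regret R(T; v_max) ≤ C · v_max · √(k·T·log T) for every v_max > 0, and regret at most C · v_max · (k/δ) · log T on every δ-gap instance with values in (0, v_max], for every δ > 0. -/

import Mathlib

open Finset

namespace MAB

/-- A realization of clicks: for each agent and each round, whether the agent
would be clicked if shown at that round. -/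
abbrev Realization (k T : ℕ) := Fin k → Fin T → Bool

/-- A deterministic allocation rule: maps a bid profile, a realization and a round
to the agent chosen at that round. -/
abbrev Alloc (k T : ℕ) := (Fin k → ℝ) → Realization k T → Fin T → Fin k

/-- A payment rule: maps a bid profile and a realization to the payment
charged to each agent. -/
abbrev Payment (k T : ℕ) := (Fin k → ℝ) → Realization k T → Fin k → ℝ

variable {k T : ℕ}

/-- A bid profile consists of positive reals. -/
def PosBids (b : Fin k → ℝ) : Prop := ∀ i, 0 < b i

/-- The allocation rule is online: the choice at round `t` is determined by the bids
and the bits observed at rounds `s < t`. -/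
def Online (A : Alloc k T) : Prop :=
  ∀ (b : Fin k → ℝ) (ρ ρ' : Realization k T) (t : Fin T),
    (∀ s : Fin T, s < t → ρ (A b ρ s) s = ρ' (A b ρ s) s) → A b ρ t = A b ρ' t

/-- The click-allocation: the number of rounds in which agent `i` is chosen and clicked. -/
def clicks (A : Alloc k T) (b : Fin k → ℝ) (ρ : Realization k T) (i : Fin k) : ℕ :=
  (univ.filter fun t : Fin T => A b ρ t = i ∧ ρ i t = true).card

/-- The payment rule only uses clicks actually observed by the allocation rule. -/
def PaymentObservable (A : Alloc k T) (P : Payment k T) : Prop :=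
  ∀ (b : Fin k → ℝ) (ρ ρ' : Realization k T),
    (∀ t : Fin T, ρ (A b ρ t) t = ρ' (A b ρ t) t) → P b ρ = P b ρ'

/-- The mechanism is normalized: `0 ≤ P_i(b;ρ) ≤ b_i · C_i(b;ρ)`. -/
def Normalized (A : Alloc k T) (P : Payment k T) : Prop :=
  ∀ (b : Fin k → ℝ) (ρ : Realization k T) (i : Fin k), PosBids b →
    0 ≤ P b ρ i ∧ P b ρ i ≤ b i * (clicks A b ρ i : ℝ)

/-- The mechanism is truthful: bidding the true value dominates any other bid. -/
def Truthful (A : Alloc k T) (P : Payment k T) : Prop :=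
  ∀ (b : Fin k → ℝ) (ρ : Realization k T) (i : Fin k) (v : ℝ), PosBids b → 0 < v →
    v * (clicks A (Function.update b i v) ρ i : ℝ) - P (Function.update b i v) ρ i ≥
      v * (clicks A b ρ i : ℝ) - P b ρ i

/-- Pointwise monotonicity: an agent that is played keeps the impression
after increasing her bid. -/
def PointwiseMonotone (A : Alloc k T) : Prop :=
  ∀ (b : Fin k → ℝ) (ρ : Realization k T) (t : Fin T) (i : Fin k) (x : ℝ),
    PosBids b → A b ρ t = i → b i < x → A (Function.update b i x) ρ t = i

/-- `flip ρ i t` is `ρ ⊕ 1(i,t)`: the realization with the bit of agent `i`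
at round `t` flipped. -/
def flip (ρ : Realization k T) (i : Fin k) (t : Fin T) : Realization k T :=
  fun j s => if j = i ∧ s = t then !(ρ j s) else ρ j s

/-- Round `t` is `(b;ρ)`-influential. -/
def InfluentialAt (A : Alloc k T) (b : Fin k → ℝ) (ρ : Realization k T) (t : Fin T) : Prop :=
  ∃ t' : Fin T, t < t' ∧ A b ρ t' ≠ A b (flip ρ (A b ρ t) t) t'

/-- Round `t` is influential for realization `ρ`. -/
def Influential (A : Alloc k T) (ρ : Realization k T) (t : Fin T) : Prop :=
  ∃ b : Fin k → ℝ, PosBids b ∧ InfluentialAt A b ρ t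

/-- The allocation rule is exploration-separated: in any influential round
the allocation does not depend on the bids. -/
def ExplorationSeparated (A : Alloc k T) : Prop :=
  ∀ (ρ : Realization k T) (t : Fin T), Influential A ρ t →
    ∀ b b' : Fin k → ℝ, PosBids b → PosBids b' → A b ρ t = A b' ρ t

/-- Round `t` is `(b;ρ)`-influential with influenced agent `i`. -/
def InfluencedAgent (A : Alloc k T) (b : Fin k → ℝ) (ρ : Realization k T) (t : Fin T)
    (i : Fin k) : Prop :=
  ∃ t' : Fin T, t < t' ∧ A b ρ t' ≠ A b (flip ρ (A b ρ t) t) t' ∧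
    (i = A b ρ t' ∨ i = A b (flip ρ (A b ρ t) t) t')

/-- Round `t` is `(b;ρ)`-secured from agent `i`. -/
def SecuredFrom (A : Alloc k T) (b : Fin k → ℝ) (ρ : Realization k T) (t : Fin T)
    (i : Fin k) : Prop :=
  ∀ x : ℝ, b i < x → A (Function.update b i x) ρ t = A b ρ t

/-- The allocation rule is weakly separated. -/
def WeaklySeparated (A : Alloc k T) : Prop :=
  ∀ (b : Fin k → ℝ) (ρ : Realization k T) (t : Fin T) (i : Fin k),
    PosBids b → InfluencedAgent A b ρ t i → SecuredFrom A b ρ t i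

/-- Non-degeneracy of the allocation rule. -/
def NonDegenerate (A : Alloc k T) : Prop :=
  ∀ (b : Fin k → ℝ) (ρ : Realization k T) (t t' : Fin T), PosBids b → t ≤ t' →
    ∃ l u : ℝ, l < u ∧ l ≤ b (A b ρ t) ∧ b (A b ρ t) ≤ u ∧
      ∀ x ∈ Set.Icc l u, ∀ φ ∈ ({ρ, flip ρ (A b ρ t) t} : Set (Realization k T)),
        ∀ s ∈ ({t, t'} : Set (Fin T)),
          (A (Function.update b (A b ρ t) x) φ s = A b ρ t ↔ A b φ s = A b ρ t)

/-- The allocation rule is scale-free. -/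
def ScaleFree (A : Alloc k T) : Prop :=
  ∀ (c : ℝ) (b : Fin k → ℝ) (ρ : Realization k T) (t : Fin T), 0 < c → PosBids b →
    A (fun j => c * b j) ρ t = A b ρ t

/-- Independence of irrelevant alternatives. -/
def IIA (A : Alloc k T) : Prop :=
  ∀ (b : Fin k → ℝ) (ρ : Realization k T) (t : Fin T) (i : Fin k) (x : ℝ),
    PosBids b → 0 < x → A b ρ t ≠ A (Function.update b i x) ρ t →
    (A b ρ t = i ∨ A (Function.update b i x) ρ t = i)

/-- Round `t` is bid-independent w.r.t. realization `ρ`. -/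
def BidIndependent (A : Alloc k T) (ρ : Realization k T) (t : Fin T) : Prop :=
  ∀ b b' : Fin k → ℝ, PosBids b → PosBids b' → A b ρ t = A b' ρ t

/-- The probability of realization `ρ` when clicks are independent Bernoulli
with CTR vector `μ`. -/
noncomputable def prob (μ : Fin k → ℝ) (ρ : Realization k T) : ℝ :=
  ∏ i : Fin k, ∏ t : Fin T, if ρ i t then μ i else 1 - μ i

/-- A valid CTR vector: all entries in `[0,1]`. -/
def ValidCTR (μ : Fin k → ℝ) : Prop := ∀ i, 0 ≤ μ i ∧ μ i ≤ 1

/-- A valid value profile: all values in `(0, vmax]`. -/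
def ValidValues (vmax : ℝ) (v : Fin k → ℝ) : Prop := ∀ i, 0 < v i ∧ v i ≤ vmax

/-- The regret of allocation rule `A` on the instance with CTRs `μ` and values `v`
(bids equal to the true values). -/
noncomputable def regret (A : Alloc k T) (μ v : Fin k → ℝ) : ℝ :=
  (T : ℝ) * (⨆ i : Fin k, μ i * v i) -
    ∑ ρ : Realization k T, prob μ ρ * ∑ t : Fin T, μ (A v ρ t) * v (A v ρ t)

/-- The worst-case regret `R(T; vmax)`. -/
noncomputable def worstRegret (A : Alloc k T) (vmax : ℝ) : ℝ :=
  sSup {r : ℝ | ∃ μ v : Fin k → ℝ, ValidCTR μ ∧ ValidValues vmax v ∧ r = regret A μ v}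

/-- The instance `(μ, v)` has `δ`-gap: the largest product `μ_i v_i` exceeds
the second largest by `δ · max_i v_i`. -/
def HasGap (μ v : Fin k → ℝ) (δ : ℝ) : Prop :=
  ∃ i : Fin k, (∀ j, μ j * v j ≤ μ i * v i) ∧
    μ i * v i - (⨆ j : {j : Fin k // j ≠ i}, μ j.1 * v j.1) = δ * (⨆ j : Fin k, v j)

/-- The worst-case regret over `δ`-gap instances, `R_δ(T; vmax)`. -/
noncomputable def worstGapRegret (A : Alloc k T) (vmax δ : ℝ) : ℝ :=
  sSup {r : ℝ | ∃ μ v : Fin k → ℝ,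
    ValidCTR μ ∧ ValidValues vmax v ∧ HasGap μ v δ ∧ r = regret A μ v}

/-! ### Successive elimination from confidence intervals -/

section Survivors

variable {L U L' U' : Fin k → ℕ → ℝ}

open scoped Classical in
/-- Agents surviving the first `p` phases when, at the end of each phase, every agent whose upper
bound lies below the lower bound of some surviving agent is eliminated. -/
noncomputable def survivors (L U : Fin k → ℕ → ℝ) : ℕ → Finset (Fin k)
  | 0 => univ
  | p + 1 => (survivors L U p).filter fun j => ∀ l ∈ survivors L U p, L l (p + 1) ≤ U j (p + 1)

theorem mem_survivors_succ {p : ℕ} {j : Fin k} :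
    j ∈ survivors L U (p + 1) ↔
      j ∈ survivors L U p ∧ ∀ l ∈ survivors L U p, L l (p + 1) ≤ U j (p + 1) := by
  simp [survivors]

theorem survivors_antitone : Antitone (survivors L U) :=
  antitone_nat_of_succ_le fun _ _ hj => (mem_survivors_succ.1 hj).1

theorem exists_mem_survivors_succ_ge (hLU : ∀ j p, L j p ≤ U j p) {p : ℕ} {m : Fin k}
    (hm : m ∈ survivors L U p) : ∃ m' ∈ survivors L U (p + 1), L m (p + 1) ≤ L m' (p + 1) := by
  obtain ⟨m', hm', hmax⟩ := exists_max_image (survivors L U p) (fun l => L l (p + 1)) ⟨m, hm⟩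
  exact ⟨m', mem_survivors_succ.2 ⟨hm', fun l hl => (hmax l hl).trans (hLU _ _)⟩, hmax m hm⟩

theorem survivors_nonempty [NeZero k] (hLU : ∀ j p, L j p ≤ U j p) (p : ℕ) :
    (survivors L U p).Nonempty := by
  induction p with
  | zero => exact ⟨0, by simp [survivors]⟩
  | succ p ih =>
    obtain ⟨m, hm⟩ := ih
    obtain ⟨m', hm', -⟩ := exists_mem_survivors_succ_ge hLU hm
    exact ⟨m', hm'⟩

theorem exists_survivor_dominating (hLU : ∀ j p, L j p ≤ U j p) (hL : ∀ j, Monotone (L j))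
    (hU : ∀ j, Antitone (U j)) {p : ℕ} {l : Fin k} (hl : l ∉ survivors L U p) :
    ∃ m ∈ survivors L U p, U l p ≤ L m p := by
  induction p with
  | zero => simp [survivors] at hl
  | succ p ih =>
    obtain ⟨m, hm, hlm⟩ : ∃ m ∈ survivors L U p, U l (p + 1) ≤ L m (p + 1) := by
      by_cases hlp : l ∈ survivors L U p
      · by_contra! h
        exact hl (mem_survivors_succ.2 ⟨hlp, fun m hm => (h m hm).le⟩)
      · obtain ⟨m, hm, h⟩ := ih hlp
        exact ⟨m, hm, (hU l p.le_succ).trans (h.trans (hL m p.le_succ))⟩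
    obtain ⟨m', hm', h⟩ := exists_mem_survivors_succ_ge hLU hm
    exact ⟨m', hm', hlm.trans h⟩

theorem survivors_congr {p : ℕ}
    (h : ∀ q < p, ∀ j ∈ survivors L U q, L j (q + 1) = L' j (q + 1) ∧ U j (q + 1) = U' j (q + 1)) :
    survivors L U p = survivors L' U' p := by
  induction p with
  | zero => rfl
  | succ p ih =>
    have e := ih fun q hq => h q (hq.trans p.lt_succ_self)
    ext j
    rw [mem_survivors_succ, mem_survivors_succ, ← e]
    refine and_congr_right fun hj => forall₂_congr fun l hl => ?_
    rw [(h p p.lt_succ_self l hl).1, (h p p.lt_succ_self j hj).2]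

/-- Raising the bounds of agent `i` keeps `i` alive longer and only helps to eliminate
the other agents. -/
theorem survivors_raise (hLU : ∀ j p, L j p ≤ U j p) (hU : ∀ j, Antitone (U j))
    (hLU' : ∀ j p, L' j p ≤ U' j p) (hL' : ∀ j, Monotone (L' j)) (hU' : ∀ j, Antitone (U' j))
    {i : Fin k} (hiL : ∀ p, L i p ≤ L' i p) (hiU : ∀ p, U i p ≤ U' i p)
    (hne : ∀ j, j ≠ i → L' j = L j ∧ U' j = U j) {p : ℕ} (hi : i ∈ survivors L U p) :
    i ∈ survivors L' U' p ∧ survivors L' U' p ⊆ survivors L U p := by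
  induction p with
  | zero => simp [survivors]
  | succ p ih =>
    obtain ⟨hip, hib⟩ := mem_survivors_succ.1 hi
    obtain ⟨hip', hsub⟩ := ih hip
    refine ⟨mem_survivors_succ.2 ⟨hip', fun l hl => ?_⟩, fun j hj => ?_⟩
    · rcases eq_or_ne l i with rfl | hli
      · exact hLU' _ _
      · rw [(hne l hli).1]
        exact (hib l (hsub hl)).trans (hiU _)
    · rcases eq_or_ne j i with rfl | hji
      · exact hi
      obtain ⟨hjp, hjb⟩ := mem_survivors_succ.1 hj
      refine mem_survivors_succ.2 ⟨hsub hjp, fun l _ => ?_⟩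
      rw [(hne j hji).2] at hjb
      by_cases hl' : l ∈ survivors L' U' p
      · refine le_trans ?_ (hjb l hl')
        rcases eq_or_ne l i with rfl | hli
        · exact hiL _
        · rw [(hne l hli).1]
      · have hli : l ≠ i := fun h => hl' (h ▸ hip')
        obtain ⟨m, hm, hlm⟩ := exists_survivor_dominating hLU' hL' hU' hl'
        rw [(hne l hli).2] at hlm
        calc L l (p + 1) ≤ U l (p + 1) := hLU _ _
          _ ≤ U l p := hU l p.le_succ
          _ ≤ L' m p := hlm
          _ ≤ L' m (p + 1) := hL' m p.le_succ
          _ ≤ U j (p + 1) := hjb m hm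

theorem mem_survivors_of_best {c : Fin k → ℝ} {i : Fin k} (hi : ∀ j, c j ≤ c i) {p : ℕ}
    (hc : ∀ q ≤ p, ∀ j, L j q ≤ c j ∧ c j ≤ U j q) : i ∈ survivors L U p := by
  induction p with
  | zero => simp [survivors]
  | succ p ih =>
    exact mem_survivors_succ.2 ⟨ih fun q hq => hc q (hq.trans p.le_succ), fun l _ =>
      (hc _ le_rfl l).1.trans ((hi l).trans (hc _ le_rfl i).2)⟩

end Survivors

/-! ### Nested confidence intervals for a sequence of bits -/

section Bounds

/-- The number of successes among the first `n` bits. -/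
def successes (x : ℕ → Bool) (n : ℕ) : ℝ := ∑ m ∈ range n, if x m then 1 else 0

/-- The confidence radius after `n` samples. -/
noncomputable def radius (T n : ℕ) : ℝ := Real.sqrt (4 * Real.log T / n)

/-- Confidence bounds after `n` samples, each interval being nested in the previous one. -/
noncomputable def bounds (T : ℕ) (x : ℕ → Bool) : ℕ → ℝ × ℝ
  | 0 => (0, 1)
  | n + 1 =>
    (max (bounds T x n).1 (min (successes x (n + 1) / (n + 1 : ℕ) - radius T (n + 1))
        (bounds T x n).2),
      max (bounds T x n).1 (min (successes x (n + 1) / (n + 1 : ℕ) + radius T (n + 1))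
        (bounds T x n).2))

theorem radius_nonneg (T n : ℕ) : 0 ≤ radius T n := Real.sqrt_nonneg _

theorem bounds_fst_le_snd (T : ℕ) (x : ℕ → Bool) (n : ℕ) :
    (bounds T x n).1 ≤ (bounds T x n).2 := by
  cases n with
  | zero => simp [bounds]
  | succ n =>
    simp only [bounds]
    have := radius_nonneg T (n + 1)
    gcongr
    linarith

theorem bounds_fst_monotone (T : ℕ) (x : ℕ → Bool) : Monotone fun n => (bounds T x n).1 :=
  monotone_nat_of_le_succ fun _ => le_max_left _ _

theorem bounds_snd_antitone (T : ℕ) (x : ℕ → Bool) : Antitone fun n => (bounds T x n).2 :=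
  antitone_nat_of_succ_le fun n => max_le (bounds_fst_le_snd T x n) (min_le_right _ _)

theorem bounds_fst_nonneg (T : ℕ) (x : ℕ → Bool) (n : ℕ) : 0 ≤ (bounds T x n).1 :=
  bounds_fst_monotone T x n.zero_le

theorem bounds_congr (T : ℕ) {x y : ℕ → Bool} {n : ℕ} (h : ∀ m < n, x m = y m) :
    bounds T x n = bounds T y n := by
  induction n with
  | zero => rfl
  | succ n ih =>
    have hs : successes x (n + 1) = successes y (n + 1) :=
      sum_congr rfl fun m hm => by rw [h m (mem_range.1 hm)]
    simp only [bounds, ih fun m hm => h m (hm.trans n.lt_succ_self), hs]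

/-- If all empirical means up to `n` are accurate, the bounds are correct and tight. -/
theorem bounds_accurate {T : ℕ} {x : ℕ → Bool} {c : ℝ} (h0 : 0 ≤ c) (h1 : c ≤ 1) {n : ℕ}
    (h : ∀ m, 0 < m → m ≤ n → |successes x m / m - c| ≤ radius T m) :
    (bounds T x n).1 ≤ c ∧ c ≤ (bounds T x n).2 ∧
      (0 < n → c - 2 * radius T n ≤ (bounds T x n).1 ∧ (bounds T x n).2 ≤ c + 2 * radius T n) := by
  induction n with
  | zero => simp [bounds, h0, h1]
  | succ n ih =>
    obtain ⟨hl, hu, -⟩ := ih fun m hm hmn => h m hm (hmn.trans n.le_succ)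
    have hc := abs_le.1 (h (n + 1) n.succ_pos le_rfl)
    have hr := radius_nonneg T (n + 1)
    simp only [bounds]
    refine ⟨max_le hl ((min_le_left _ _).trans (by linarith)),
      le_max_of_le_right (le_min (by linarith) hu), fun _ =>
      ⟨le_max_of_le_right (le_min (by linarith) (by linarith)),
        max_le (by linarith) ((min_le_left _ _).trans (by linarith))⟩⟩

end Bounds
/-! ### Simulating a table of samples by fresh bits -/

section Simulation

/-- A realization, extended by `false` beyond the time horizon. -/
def extend (ρ : Realization k T) (i : Fin k) (n : ℕ) : Bool :=
  if h : n < T then ρ i ⟨n, h⟩ else false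

@[simp] theorem extend_coe (ρ : Realization k T) (i : Fin k) (t : Fin T) :
    extend ρ i t = ρ i t := by
  simp [extend]

variable [NeZero k] {sched : (ℕ → Bool) → ℕ → ℕ}

/-- The agent owning a slot. Slot `j + k * p` stands for the sample of agent `j` in phase `p`. -/
def agentOf (k : ℕ) [NeZero k] (s : ℕ) : Fin k := Fin.ofNat k s

/-- The slot of agent `j` in phase `p`. -/
def slot (j : Fin k) (p : ℕ) : ℕ := j + k * p

@[simp] theorem agentOf_slot (j : Fin k) (p : ℕ) : agentOf k (slot j p) = j := by
  ext
  simp [agentOf, slot, Nat.mod_eq_of_lt j.2]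

@[simp] theorem slot_div (j : Fin k) (p : ℕ) : slot j p / k = p := by
  simp [slot, Nat.add_mul_div_left _ _ (NeZero.pos k), Nat.div_eq_of_lt j.2]

@[simp] theorem slot_agentOf (s : ℕ) : slot (agentOf k s) (s / k) = s := by
  simp [agentOf, slot, Nat.mod_add_div]

/-- A schedule, assigning to each table of samples the sequence of slots to be read, is adaptive
if each slot depends only on the samples read before. -/
def Adaptive (sched : (ℕ → Bool) → ℕ → ℕ) : Prop :=
  ∀ (τ τ' : ℕ → Bool) (t : ℕ), (∀ s < t, τ (sched τ s) = τ' (sched τ s)) → sched τ t = sched τ' t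

open scoped Classical in
/-- The slots read when the sample read at round `t` is the bit at round `t` of the agent owning
the slot. -/
noncomputable def run (sched : (ℕ → Bool) → ℕ → ℕ) (ρ : Fin k → ℕ → Bool) (t : ℕ) : ℕ :=
  sched (fun x => decide (∃ s : Fin t, run sched ρ s = x ∧ ρ (agentOf k x) s = true)) t
termination_by t
decreasing_by all_goals exact Fin.is_lt _

open scoped Classical in
/-- The table of the samples read before round `t`. -/
noncomputable def partialTable (sched : (ℕ → Bool) → ℕ → ℕ) (ρ : Fin k → ℕ → Bool) (t x : ℕ) :
    Bool :=
  decide (∃ s : Fin t, run sched ρ s = x ∧ ρ (agentOf k x) s = true)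

variable {ρ : Fin k → ℕ → Bool}

theorem run_eq (t : ℕ) : run sched ρ t = sched (partialTable sched ρ t) t := by
  rw [run]
  rfl

theorem sched_partialTable (hs : Adaptive sched) (hinj : ∀ τ, Function.Injective (sched τ))
    (t : ℕ) : ∀ s ≤ t, sched (partialTable sched ρ t) s = run sched ρ s := by
  induction t using Nat.strong_induction_on with
  | _ t ih =>
    intro s hst
    rcases hst.eq_or_lt with rfl | hst
    · exact (run_eq s).symm
    rw [run_eq s]
    refine (hs _ _ s fun r hr => ?_).symm
    rw [ih s hst r hr.le]
    simp only [partialTable, decide_eq_decide]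
    constructor
    · rintro ⟨q, h⟩
      exact ⟨⟨q, q.2.trans hst⟩, h⟩
    · rintro ⟨⟨q, hq⟩, h, h'⟩
      rcases lt_or_ge q s with hqs | hqs
      · exact ⟨⟨q, hqs⟩, h, h'⟩
      · have e : sched (partialTable sched ρ q) q = sched (partialTable sched ρ q) r := by
          rw [ih q hq q le_rfl, ih q hq r (hr.le.trans hqs), h]
        have := hinj _ e
        omega

theorem run_injective (hs : Adaptive sched) (hinj : ∀ τ, Function.Injective (sched τ)) :
    Function.Injective (run sched ρ) := by
  refine Function.Injective.of_lt_imp_ne fun r s hrs h => ?_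
  rw [← sched_partialTable hs hinj s r hrs.le, ← sched_partialTable hs hinj s s le_rfl] at h
  exact hrs.ne (hinj _ h)

theorem partialTable_run (hs : Adaptive sched) (hinj : ∀ τ, Function.Injective (sched τ))
    {s t : ℕ} (hst : s < t) :
    partialTable sched ρ t (run sched ρ s) = ρ (agentOf k (run sched ρ s)) s := by
  rw [partialTable, Bool.eq_iff_iff, decide_eq_true_iff]
  constructor
  · rintro ⟨q, h, h'⟩
    rwa [run_injective hs hinj h] at h'
  · exact fun h => ⟨⟨s, hst⟩, rfl, h⟩

theorem sched_eq_run (hs : Adaptive sched) (hinj : ∀ τ, Function.Injective (sched τ))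
    {τ : ℕ → Bool} {t : ℕ}
    (h : ∀ s < t, τ (run sched ρ s) = ρ (agentOf k (run sched ρ s)) s) :
    sched τ t = run sched ρ t := by
  rw [run_eq]
  refine (hs _ _ t fun s hst => ?_).symm
  rw [sched_partialTable hs hinj t s hst.le, partialTable_run hs hinj hst, h s hst]

theorem run_congr {ρ' : Fin k → ℕ → Bool} {t : ℕ}
    (h : ∀ s < t, ρ (agentOf k (run sched ρ s)) s = ρ' (agentOf k (run sched ρ s)) s) :
    run sched ρ t = run sched ρ' t := by
  induction t using Nat.strong_induction_on with
  | _ t ih =>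
    rw [run_eq, run_eq]
    congr 1
    funext x
    simp only [partialTable, decide_eq_decide]
    refine exists_congr fun s => ?_
    rw [← ih s s.2 fun r hr => h r (hr.trans s.2)]
    refine and_congr_right fun e => ?_
    rw [← e, h s s.2]

/-- The table of samples whose sample for agent `j` in phase `p` is the bit `σ j p`. -/
def tableOf (σ : Realization k T) (s : ℕ) : Bool := extend σ (agentOf k s) (s / k)

/-- The schedule reads, up to round `T`, only samples of the first `T` phases. -/
theorem exists_table_of_run (hs : Adaptive sched)
    (hinj : ∀ τ, Function.Injective (sched τ)) (hT : ∀ τ, ∀ t < T, sched τ t / k < T) :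
    ∃ Φ : Realization k T → Realization k T, Function.Bijective Φ ∧
      (∀ μ ρ, prob μ (Φ ρ) = prob μ ρ) ∧
      ∀ (ρ : Realization k T) (t : Fin T),
        sched (tableOf (Φ ρ)) t = run sched (extend ρ) t ∧
        tableOf (Φ ρ) (run sched (extend ρ) t) = ρ (agentOf k (run sched (extend ρ) t)) t := by
  classical
  have key : ∀ c : Fin T → ℕ, ∃ e : Fin k → Equiv.Perm (Fin T), Function.Injective c →
      ∀ (t : Fin T) (h : c t / k < T), e (agentOf k (c t)) ⟨c t / k, h⟩ = t := by
    intro c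
    by_cases hc : Function.Injective c
    swap
    · exact ⟨fun _ => 1, fun h => absurd h hc⟩
    have : ∀ i : Fin k, ∃ e : Equiv.Perm (Fin T), ∀ (t : Fin T) (h : c t / k < T),
        agentOf k (c t) = i → e ⟨c t / k, h⟩ = t := by
      intro i
      let f : Fin T → Fin T := fun n => if h : ∃ t, c t = slot i n then h.choose else n
      have hf : ∀ n : Fin T, (∃ t, c t = slot i n) → c (f n) = slot i n := by
        intro n h
        simp only [f, dif_pos h]
        exact h.choose_spec
      obtain ⟨g, hg⟩ := Set.MapsTo.exists_equiv_extend_of_card_eq (α := Fin T) (β := Fin T)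
        (t := univ) (by simp) (s := {n : Fin T | ∃ t, c t = slot i n}) (f := f)
        (by intro x _; simp)
        (by
          intro n hn m hm hnm
          have h1 := hf n hn
          rw [hnm, hf m hm] at h1
          have := congrArg (· / k) h1
          simp only [slot_div] at this
          exact (Fin.ext this).symm)
      refine ⟨g.trans (Equiv.subtypeUnivEquiv (fun x => mem_univ x)), fun t h hi => ?_⟩
      have e : c t = slot i (⟨c t / k, h⟩ : Fin T) := by
        subst hi
        simp
      have h2 := hg ⟨c t / k, h⟩ ⟨t, e⟩
      simp only [Equiv.trans_apply, Equiv.subtypeUnivEquiv_apply, h2]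
      exact hc ((hf _ ⟨t, e⟩).trans e.symm)
    choose e he using this
    exact ⟨e, fun _ t h => he _ t h rfl⟩
  choose e he using key
  let c : Realization k T → Fin T → ℕ := fun ρ t => run sched (extend ρ) t
  have hc : ∀ ρ, Function.Injective (c ρ) := fun ρ =>
    (run_injective hs hinj).comp Fin.val_injective
  have hcT : ∀ ρ t, c ρ t / k < T := by
    intro ρ t
    simp only [c]
    rw [run_eq]
    exact hT _ _ t.2
  let Φ : Realization k T → Realization k T := fun ρ i n => ρ i (e (c ρ) i n)
  have hΦ : ∀ ρ t, tableOf (Φ ρ) (c ρ t) = ρ (agentOf k (c ρ t)) t := by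
    intro ρ t
    simp only [tableOf, extend, dif_pos (hcT ρ t), Φ, he _ (hc ρ) t (hcT ρ t)]
  have hsched : ∀ (ρ : Realization k T) (t : Fin T), sched (tableOf (Φ ρ)) t = c ρ t := by
    intro ρ t
    refine sched_eq_run hs hinj fun s hst => ?_
    have := hΦ ρ ⟨s, hst.trans t.2⟩
    simp only [c] at this
    rw [this]
    simp [extend, hst.trans t.2]
  refine ⟨Φ, Finite.injective_iff_bijective.1 fun ρ ρ' h => ?_, fun μ ρ => ?_,
    fun ρ t => ⟨hsched ρ t, hΦ ρ t⟩⟩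
  · have hcc : c ρ = c ρ' := by
      funext t
      rw [← hsched, ← hsched, h]
    funext i n
    have := congrFun (congrFun h i) ((e (c ρ) i).symm n)
    simp only [Φ] at this
    rw [← hcc] at this
    simpa using this
  · unfold prob
    refine prod_congr rfl fun i _ => ?_
    exact Equiv.prod_comp (e (c ρ) i) fun t => if ρ i t = true then μ i else 1 - μ i

end Simulation

/-! ### The allocation rule -/

section Rule

variable {b b' : Fin k → ℝ} {τ τ' : ℕ → Bool}

/-- The samples of agent `j` in a table. -/
def samples (τ : ℕ → Bool) (j : Fin k) (p : ℕ) : Bool := τ (slot j p)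

/-- Agents still active in phase `p`, confidence bounds being scaled by the bids. -/
noncomputable def active (T : ℕ) (b : Fin k → ℝ) (τ : ℕ → Bool) : ℕ → Finset (Fin k) :=
  survivors (fun j p => |b j| * (bounds T (samples τ j) p).1)
    fun j p => |b j| * (bounds T (samples τ j) p).2

theorem scaled_bounds_le (T : ℕ) (b : Fin k → ℝ) (τ : ℕ → Bool) (j : Fin k) (p : ℕ) :
    |b j| * (bounds T (samples τ j) p).1 ≤ |b j| * (bounds T (samples τ j) p).2 :=
  mul_le_mul_of_nonneg_left (bounds_fst_le_snd _ _ _) (abs_nonneg _)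

theorem active_antitone : Antitone (active T b τ) := survivors_antitone

theorem lt_of_div_lt {s p : ℕ} (j : Fin k) (h : p < s / k) : slot j p < s := by
  have := Nat.mul_le_of_le_div k (p + 1) s h
  have := j.2
  unfold slot
  nlinarith

variable [NeZero k]

/-- A slot is used if its agent is active in its phase. -/
def Used (T : ℕ) (b : Fin k → ℝ) (τ : ℕ → Bool) (s : ℕ) : Prop :=
  agentOf k s ∈ active T b τ (s / k)

/-- The used slots, in order. -/
noncomputable def schedule (T : ℕ) (b : Fin k → ℝ) (τ : ℕ → Bool) (t : ℕ) : ℕ :=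
  Nat.nth (Used T b τ) t

/-- Successive elimination, where each phase samples every active agent once. -/
noncomputable def eliminationRule (k T : ℕ) [NeZero k] : Alloc k T := fun b ρ t =>
  agentOf k (run (schedule T b) (extend ρ) t)

theorem active_nonempty (p : ℕ) : (active T b τ p).Nonempty :=
  survivors_nonempty (scaled_bounds_le T b τ) p

theorem le_count_used [DecidablePred (Used T b τ)] (s : ℕ) :
    s / k ≤ Nat.count (Used T b τ) s := by
  choose f hf using active_nonempty (T := T) (b := b) (τ := τ)
  rw [Nat.count_eq_card_filter_range, ← card_range (s / k)]
  refine card_le_card_of_injOn (fun p => slot (f p) p) (fun p hp => ?_) fun p _ q _ h => ?_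
  · simp only [coe_range, Set.mem_Iio] at hp
    rw [mem_coe, mem_filter, mem_range]
    exact ⟨lt_of_div_lt (f p) hp, by simp [Used, hf p]⟩
  · simpa using congrArg (· / k) h

theorem infinite_used : (Set.ofPred (Used T b τ)).Infinite := by
  choose f hf using active_nonempty (T := T) (b := b) (τ := τ)
  refine Set.infinite_of_injective_forall_mem (f := fun p => slot (f p) p)
    (fun p q h => by simpa using congrArg (· / k) h) fun p => ?_
  simp [Used, hf p]

theorem used_schedule (t : ℕ) : Used T b τ (schedule T b τ t) := Nat.nth_mem_of_infinite infinite_used t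

theorem schedule_injective (T : ℕ) (b : Fin k → ℝ) (τ : ℕ → Bool) :
    Function.Injective (schedule T b τ) := Nat.nth_injective infinite_used

theorem count_schedule [DecidablePred (Used T b τ)] (t : ℕ) :
    Nat.count (Used T b τ) (schedule T b τ t) = t := Nat.count_nth_of_infinite infinite_used t

theorem schedule_div_le (t : ℕ) : schedule T b τ t / k ≤ t := by
  classical
  simpa [count_schedule] using le_count_used (T := T) (b := b) (τ := τ) (schedule T b τ t)

theorem active_congr {p : ℕ} (h : ∀ s, s / k < p → Used T b τ s → τ s = τ' s) :
    active T b τ p = active T b τ' p := by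
  refine survivors_congr fun q hq j hj => ?_
  have : bounds T (samples τ j) (q + 1) = bounds T (samples τ' j) (q + 1) := by
    refine bounds_congr T fun m hm => h _ (by rw [slot_div]; omega) ?_
    simpa [Used] using active_antitone (Nat.lt_succ_iff.1 hm) hj
  simp [this]

theorem used_congr {s : ℕ} (h : ∀ r < s, Used T b τ r → τ r = τ' r) :
    Used T b τ s ↔ Used T b τ' s := by
  rw [Used, Used, active_congr fun r hr => h r (lt_of_not_ge fun hsr =>
    absurd (Nat.div_le_div_right (c := k) hsr) (not_le.2 hr))]

theorem adaptive_schedule (T : ℕ) (b : Fin k → ℝ) : Adaptive (schedule T b) := by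
  classical
  intro τ τ' t h
  set s := schedule T b τ t with hs
  have hcount : Nat.count (Used T b τ) s = t := count_schedule t
  have hagree : ∀ r < s, Used T b τ r → τ r = τ' r := by
    intro r hr hu
    have := h (Nat.count (Used T b τ) r)
      (by rw [← hcount]; exact Nat.count_strict_mono hu hr)
    rwa [schedule, Nat.nth_count hu] at this
  have hiff : ∀ r ≤ s, (Used T b τ r ↔ Used T b τ' r) := fun r hr =>
    used_congr fun q hq => hagree q (hq.trans_le hr)
  have hcount' : Nat.count (Used T b τ') s = t := by
    rw [← hcount, Nat.count_eq_card_filter_range, Nat.count_eq_card_filter_range]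
    exact congrArg card (filter_congr fun r hr => (hiff r (mem_range.1 hr).le).symm)
  have hus : Used T b τ' s := (hiff s le_rfl).1 (used_schedule t)
  rw [schedule, ← hcount', Nat.nth_count hus]

theorem online_eliminationRule : Online (eliminationRule k T) := by
  intro b ρ ρ' t h
  unfold eliminationRule
  rw [run_congr fun s hs => ?_]
  have := h ⟨s, hs.trans t.2⟩ hs
  simpa [extend, hs.trans t.2, eliminationRule] using this

/-- Expectations of functions of the chosen agents and observed bits can be computed as if
a table of samples were read. -/
theorem sum_prob_eliminationRule (μ b : Fin k → ℝ) (F : (Fin T → Fin k) → (Fin T → Bool) → ℝ) :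
    ∑ ρ, prob μ ρ * F (eliminationRule k T b ρ) (fun t => ρ (eliminationRule k T b ρ t) t) =
      ∑ σ : Realization k T, prob μ σ *
        F (fun t => agentOf k (schedule T b (tableOf σ) t))
          (fun t => tableOf σ (schedule T b (tableOf σ) t)) := by
  obtain ⟨Φ, hΦ, hprob, h⟩ := exists_table_of_run (T := T) (adaptive_schedule T b)
    (schedule_injective T b) fun τ t ht => (schedule_div_le t).trans_lt ht
  refine Fintype.sum_bijective Φ hΦ _ _ fun ρ => ?_
  simp only [hprob, (h ρ _).1, (h ρ _).2]
  rfl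

theorem used_raise {i : Fin k} (hi : |b i| ≤ |b' i|) (hne : ∀ j, j ≠ i → b' j = b j) {s : ℕ}
    (hs : agentOf k s = i) (hu : Used T b τ s) [DecidablePred (Used T b τ)]
    [DecidablePred (Used T b' τ)] :
    Used T b' τ s ∧ Nat.count (Used T b' τ) s ≤ Nat.count (Used T b τ) s := by
  have key : ∀ p, i ∈ active T b τ p →
      i ∈ active T b' τ p ∧ active T b' τ p ⊆ active T b τ p := by
    refine fun p hp => survivors_raise (scaled_bounds_le T b τ) (fun j => ?_)
      (scaled_bounds_le T b' τ) (fun j => ?_) (fun j => ?_) (fun p => ?_) (fun p => ?_)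
      (fun j hj => ?_) hp
    · exact (bounds_snd_antitone T _).const_mul (abs_nonneg _)
    · exact (bounds_fst_monotone T _).const_mul (abs_nonneg _)
    · exact (bounds_snd_antitone T _).const_mul (abs_nonneg _)
    · exact mul_le_mul_of_nonneg_right hi (bounds_fst_nonneg _ _ _)
    · exact mul_le_mul_of_nonneg_right hi
        ((bounds_fst_nonneg _ _ _).trans (bounds_fst_le_snd _ _ _))
    · simp [hne j hj]
  rw [Used, hs] at hu
  refine ⟨by rw [Used, hs]; exact (key _ hu).1, ?_⟩
  rw [Nat.count_eq_card_filter_range, Nat.count_eq_card_filter_range]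
  refine card_le_card fun r hr => ?_
  rw [mem_filter, mem_range] at hr ⊢
  exact ⟨hr.1, (key _ (active_antitone (Nat.div_le_div_right hr.1.le) hu)).2 hr.2⟩

theorem clicks_table_mono {i : Fin k} (hi : |b i| ≤ |b' i|) (hne : ∀ j, j ≠ i → b' j = b j) :
    #{t : Fin T | agentOf k (schedule T b τ t) = i ∧ τ (schedule T b τ t) = true} ≤
      #{t : Fin T | agentOf k (schedule T b' τ t) = i ∧ τ (schedule T b' τ t) = true} := by
  classical
  have key : ∀ t : Fin T, agentOf k (schedule T b τ t) = i →
      ∃ t' : Fin T, schedule T b' τ t' = schedule T b τ t := by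
    intro t ht
    obtain ⟨hu, hc⟩ := used_raise hi hne ht (used_schedule (T := T) (b := b) (τ := τ) t)
    rw [count_schedule] at hc
    exact ⟨⟨_, hc.trans_lt t.2⟩, Nat.nth_count hu⟩
  choose! f hf using key
  refine card_le_card_of_injOn f (fun t ht => ?_) fun t ht r hr h => ?_
  · simp only [coe_filter, mem_univ, true_and, Set.mem_ofPred_eq] at ht ⊢
    rwa [hf t ht.1]
  · simp only [coe_filter, mem_univ, true_and, Set.mem_ofPred_eq] at ht hr
    have e := hf t ht.1
    rw [h, hf r hr.1] at e
    exact Fin.ext (schedule_injective T b τ e).symm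

end Rule

/-! ### Concentration of the empirical means -/

section Concentration

variable {μ : Fin k → ℝ}

theorem prob_nonneg (hμ : ValidCTR μ) (ρ : Realization k T) : 0 ≤ prob μ ρ := by
  refine prod_nonneg fun i _ => prod_nonneg fun t _ => ?_
  split_ifs
  · exact (hμ i).1
  · linarith [(hμ i).2]

theorem sum_prob_mul_prod (μ : Fin k → ℝ) (f : Fin k → Fin T → Bool → ℝ) :
    ∑ ρ, prob μ ρ * ∏ i, ∏ t, f i t (ρ i t) =
      ∏ i, ∏ t, (μ i * f i t true + (1 - μ i) * f i t false) := by
  have h : ∀ i t, μ i * f i t true + (1 - μ i) * f i t false =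
      ∑ x : Bool, (if x then μ i else 1 - μ i) * f i t x := by simp
  simp only [h, Fintype.prod_sum, prob, ← prod_mul_distrib]

theorem sum_prob (μ : Fin k → ℝ) : ∑ ρ : Realization k T, prob μ ρ = 1 := by
  simpa using sum_prob_mul_prod (T := T) μ fun _ _ _ => 1

theorem bernoulli_mgf_le {c s : ℝ} (h0 : 0 ≤ c) (h1 : c ≤ 1) (hs : |s| ≤ 1) :
    c * Real.exp (s * (1 - c)) + (1 - c) * Real.exp (s * (0 - c)) ≤ Real.exp (s ^ 2 / 4) := by
  have hexp : ∀ y : ℝ, |y| ≤ 1 → Real.exp y ≤ 1 + y + y ^ 2 := fun y hy => by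
    linarith [(abs_le.1 (Real.abs_exp_sub_one_sub_id_le hy)).2]
  have e1 := hexp (s * (1 - c)) (by
    rw [abs_mul]
    exact mul_le_one₀ hs (abs_nonneg _) (abs_le.2 ⟨by linarith, by linarith⟩))
  have e2 := hexp (s * (0 - c)) (by
    rw [abs_mul]
    exact mul_le_one₀ hs (abs_nonneg _) (abs_le.2 ⟨by linarith, by linarith⟩))
  have e3 := mul_le_mul_of_nonneg_left e1 h0
  have e4 := mul_le_mul_of_nonneg_left e2 (sub_nonneg.2 h1)
  have e5 := Real.add_one_le_exp (s ^ 2 / 4)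
  nlinarith [mul_nonneg (sq_nonneg s) (sq_nonneg (2 * c - 1))]

theorem exp_successes (ρ : Realization k T) (j : Fin k) {n : ℕ} (hn : n ≤ T) (s c : ℝ) :
    ∏ i, ∏ t : Fin T, (if i = j ∧ (t : ℕ) < n then
        Real.exp (s * ((if ρ i t then 1 else 0) - c)) else 1) =
      Real.exp (s * (successes (extend ρ j) n - n * c)) := by
  rw [prod_eq_single j (fun i _ hi => by simp [hi]) (by simp)]
  have h : ∀ t : Fin T, (if j = j ∧ (t : ℕ) < n then
      Real.exp (s * ((if ρ j t then 1 else 0) - c)) else 1) =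
      (fun m : ℕ => if m < n then
        Real.exp (s * ((if extend ρ j m then 1 else 0) - c)) else 1) t := by
    simp
  rw [prod_congr rfl fun t _ => h t, Fin.prod_univ_eq_prod_range (fun m : ℕ => if m < n then
      Real.exp (s * ((if extend ρ j m then 1 else 0) - c)) else 1) T, ← prod_filter]
  have hf : (range T).filter (· < n) = range n := by
    ext m
    simp only [mem_filter, mem_range]
    omega
  rw [hf, ← Real.exp_sum, ← mul_sum, sum_sub_distrib]
  simp [successes]

theorem sum_prob_chernoff (hμ : ValidCTR μ) (j : Fin k) {n : ℕ} (hn : n ≤ T) {s : ℝ}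
    (hs : |s| ≤ 1) (a : ℝ) :
    ∑ ρ : Realization k T, prob μ ρ *
        (if a ≤ s * (successes (extend ρ j) n - n * μ j) then 1 else 0) ≤
      Real.exp (n * (s ^ 2 / 4) - a) := by
  have hle : ∀ ρ : Realization k T, prob μ ρ *
      (if a ≤ s * (successes (extend ρ j) n - n * μ j) then 1 else 0) ≤
      prob μ ρ * Real.exp (s * (successes (extend ρ j) n - n * μ j)) * Real.exp (-a) := by
    intro ρ
    rw [mul_assoc, ← Real.exp_add]
    refine mul_le_mul_of_nonneg_left ?_ (prob_nonneg hμ ρ)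
    split_ifs with h
    · exact Real.one_le_exp (by linarith)
    · exact (Real.exp_pos _).le
  refine (sum_le_sum fun ρ _ => hle ρ).trans ?_
  rw [← sum_mul, sub_eq_add_neg, Real.exp_add]
  refine mul_le_mul_of_nonneg_right ?_ (Real.exp_pos _).le
  simp only [← exp_successes _ j hn]
  rw [sum_prob_mul_prod μ fun i (t : Fin T) x => if i = j ∧ (t : ℕ) < n then
    Real.exp (s * ((if x then 1 else 0) - μ j)) else 1]
  rw [prod_eq_single j (fun i _ hi => by simp [hi]) (by simp)]
  have h : ∀ t : Fin T, (μ j * (if j = j ∧ (t : ℕ) < n then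
        Real.exp (s * ((if true = true then 1 else 0) - μ j)) else 1) +
      (1 - μ j) * (if j = j ∧ (t : ℕ) < n then
        Real.exp (s * ((if false = true then 1 else 0) - μ j)) else 1)) ≤
      if (t : ℕ) < n then Real.exp (s ^ 2 / 4) else 1 := by
    intro t
    by_cases ht : (t : ℕ) < n
    · simpa [ht] using bernoulli_mgf_le (hμ j).1 (hμ j).2 hs
    · simp [ht]
  refine (prod_le_prod (fun t _ => ?_) fun t _ => h t).trans ?_
  · have h0 := (hμ j).1
    have h1 := sub_nonneg.2 (hμ j).2
    split_ifs <;> positivity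
  · rw [Fin.prod_univ_eq_prod_range (fun m : ℕ => if m < n then Real.exp (s ^ 2 / 4) else 1) T,
      ← prod_filter]
    have hf : (range T).filter (· < n) = range n := by
      ext m
      simp only [mem_filter, mem_range]
      omega
    rw [hf, prod_const, card_range, ← Real.exp_nat_mul]

theorem successes_nonneg (x : ℕ → Bool) (n : ℕ) : 0 ≤ successes x n :=
  sum_nonneg fun m _ => by split_ifs <;> norm_num

theorem successes_le (x : ℕ → Bool) (n : ℕ) : successes x n ≤ n := by
  have : successes x n ≤ ∑ _m ∈ range n, (1 : ℝ) :=
    sum_le_sum fun m _ => by split_ifs <;> norm_num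
  simpa using this

theorem sum_prob_deviation (hμ : ValidCTR μ) (hT : 2 ≤ T) (j : Fin k) {n : ℕ} (h0 : 0 < n)
    (hn : n ≤ T) :
    ∑ ρ : Realization k T, prob μ ρ *
        (if radius T n < |successes (extend ρ j) n / n - μ j| then 1 else 0) ≤
      2 / (T : ℝ) ^ 3 := by
  have hn0 : (0 : ℝ) < n := by exact_mod_cast h0
  have hT0 : (0 : ℝ) < T := by positivity
  have hr := radius_nonneg T n
  have hlog : 0 ≤ Real.log T := Real.log_natCast_nonneg T
  have hr2 : n * radius T n ^ 2 = 4 * Real.log T := by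
    rw [radius, Real.sq_sqrt (by positivity)]
    field_simp
  rcases le_or_gt (radius T n) 1 with hr1 | hr1
  · set r := radius T n
    have hexp : Real.exp (n * (r ^ 2 / 4) - n * r ^ 2) = 1 / (T : ℝ) ^ 3 := by
      have : n * (r ^ 2 / 4) - n * r ^ 2 = -((3 : ℕ) * Real.log T) := by
        push_cast
        linarith
      rw [this, Real.exp_neg, Real.exp_nat_mul, Real.exp_log hT0, one_div]
    have h1 := sum_prob_chernoff hμ j hn (s := r) (by rwa [abs_of_nonneg hr]) (n * r ^ 2)
    have h2 := sum_prob_chernoff hμ j hn (s := -r) (by rwa [abs_neg, abs_of_nonneg hr]) (n * r ^ 2)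
    rw [hexp] at h1
    rw [neg_sq, hexp] at h2
    calc _ ≤ ∑ ρ : Realization k T, (prob μ ρ *
          (if n * r ^ 2 ≤ r * (successes (extend ρ j) n - n * μ j) then 1 else 0) + prob μ ρ *
          (if n * r ^ 2 ≤ -r * (successes (extend ρ j) n - n * μ j) then 1 else 0)) := ?_
      _ ≤ 1 / (T : ℝ) ^ 3 + 1 / (T : ℝ) ^ 3 := by
        rw [sum_add_distrib]
        exact add_le_add h1 h2
      _ = _ := by ring
    refine sum_le_sum fun ρ _ => ?_
    rw [← mul_add]
    refine mul_le_mul_of_nonneg_left ?_ (prob_nonneg hμ ρ)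
    by_cases h : r < |successes (extend ρ j) n / n - μ j|
    · have e : successes (extend ρ j) n - n * μ j = n * (successes (extend ρ j) n / n - μ j) := by
        field_simp
      rw [if_pos h, e]
      rcases lt_abs.1 h with h | h
      · rw [if_pos (by nlinarith [mul_nonneg (mul_nonneg hn0.le hr) (sub_nonneg.2 h.le)])]
        split_ifs <;> norm_num
      · rw [if_pos (c := n * r ^ 2 ≤ -r * _)
          (by nlinarith [mul_nonneg (mul_nonneg hn0.le hr) (sub_nonneg.2 h.le)])]
        split_ifs <;> norm_num
    · rw [if_neg h]
      positivity
  · rw [sum_eq_zero fun ρ _ => ?_]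
    · positivity
    · rw [if_neg, mul_zero]
      refine not_lt.2 (le_trans (abs_le.2 ⟨?_, ?_⟩) hr1.le)
      · have := div_nonneg (successes_nonneg (extend ρ j) n) hn0.le
        linarith [(hμ j).2]
      · have := (div_le_one hn0).2 (successes_le (extend ρ j) n)
        linarith [(hμ j).1]

/-- All empirical means over at most `T` samples are within the confidence radius. -/
def Accurate (μ : Fin k → ℝ) (σ : Realization k T) : Prop :=
  ∀ j n, 0 < n → n ≤ T → |successes (extend σ j) n / n - μ j| ≤ radius T n

open scoped Classical in
theorem sum_prob_not_accurate (hμ : ValidCTR μ) (hT : 2 ≤ T) :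
    ∑ σ : Realization k T, prob μ σ * (if Accurate μ σ then 0 else 1) ≤ 2 * k / (T : ℝ) ^ 2 := by
  have hT0 : (0 : ℝ) < T := by positivity
  calc _ ≤ ∑ σ : Realization k T, ∑ j : Fin k, ∑ n ∈ Icc 1 T, prob μ σ *
        (if radius T n < |successes (extend σ j) n / n - μ j| then 1 else 0) := ?_
    _ = ∑ j : Fin k, ∑ n ∈ Icc 1 T, ∑ σ : Realization k T, prob μ σ *
        (if radius T n < |successes (extend σ j) n / n - μ j| then 1 else 0) := by
      rw [sum_comm]
      exact sum_congr rfl fun j _ => sum_comm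
    _ ≤ ∑ j : Fin k, ∑ n ∈ Icc 1 T, 2 / (T : ℝ) ^ 3 := by
      refine sum_le_sum fun j _ => sum_le_sum fun n hn => ?_
      rw [mem_Icc] at hn
      exact sum_prob_deviation hμ hT j hn.1 hn.2
    _ = _ := by
      simp
      field_simp
  refine sum_le_sum fun σ _ => ?_
  have hnn : ∀ j n, 0 ≤ prob μ σ *
      (if radius T n < |successes (extend σ j) n / n - μ j| then (1 : ℝ) else 0) := fun j n =>
    mul_nonneg (prob_nonneg hμ σ) (by split_ifs <;> norm_num)
  by_cases h : Accurate μ σ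
  · rw [if_pos h, mul_zero]
    exact sum_nonneg fun j _ => sum_nonneg fun n _ => hnn j n
  · simp only [Accurate, not_forall, not_le] at h
    obtain ⟨j, n, h0, hn, h⟩ := h
    refine le_trans ?_ (single_le_sum (f := fun j => ∑ n ∈ Icc 1 T, prob μ σ *
        (if radius T n < |successes (extend σ j) n / n - μ j| then (1 : ℝ) else 0))
      (fun j _ => sum_nonneg fun n _ => hnn j n) (mem_univ j))
    refine le_trans ?_ (single_le_sum (fun n _ => hnn j n) (mem_Icc.2 ⟨h0, hn⟩))
    rw [if_pos h]
    exact mul_le_mul_of_nonneg_left (by split_ifs <;> norm_num) (prob_nonneg hμ σ)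

end Concentration

/-! ### Regret -/

section Regret

variable {μ v : Fin k → ℝ} {M : ℝ} {i : Fin k}

theorem one_half_le_log (hT : 2 ≤ T) : 1 / 2 ≤ Real.log T := by
  have h1 : Real.log 2 ≤ Real.log T := Real.log_le_log (by norm_num) (by exact_mod_cast hT)
  linarith [Real.log_two_gt_d9]

theorem regret_eq_sum_prob (A : Alloc k T) (hi : ∀ j, μ j * v j ≤ μ i * v i) :
    regret A μ v = ∑ ρ, prob μ ρ * ∑ t, (μ i * v i - μ (A v ρ t) * v (A v ρ t)) := by
  have : Nonempty (Fin k) := ⟨i⟩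
  have hsup : ⨆ j, μ j * v j = μ i * v i :=
    le_antisymm (ciSup_le hi) (le_ciSup (f := fun j => μ j * v j) (Set.finite_range _).bddAbove i)
  simp only [regret, hsup, sum_sub_distrib, mul_sub, sum_const, card_univ, Fintype.card_fin,
    nsmul_eq_mul, ← sum_mul, sum_prob, one_mul]

theorem gap_le (hμ : ValidCTR μ) (hv : ValidValues M v) (j : Fin k) :
    μ i * v i - μ j * v j ≤ M := by
  have h1 : μ i * v i ≤ 1 * M := mul_le_mul (hμ i).2 (hv i).2 (hv i).1.le zero_le_one
  linarith [mul_nonneg (hμ j).1 (hv j).1.le]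

theorem regret_le_horizon_mul (A : Alloc k T) (hμ : ValidCTR μ) (hv : ValidValues M v)
    (hi : ∀ j, μ j * v j ≤ μ i * v i) : regret A μ v ≤ T * M := by
  rw [regret_eq_sum_prob A hi]
  calc _ ≤ ∑ ρ : Realization k T, prob μ ρ * (T * M) := by
        refine sum_le_sum fun ρ _ => mul_le_mul_of_nonneg_left ?_ (prob_nonneg hμ ρ)
        simpa using sum_le_sum fun t (_ : t ∈ univ) => gap_le (i := i) hμ hv (A v ρ t)
    _ = T * M := by rw [← sum_mul, sum_prob, one_mul]

variable [NeZero k]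

theorem samples_tableOf (σ : Realization k T) (j : Fin k) :
    samples (tableOf σ) j = extend σ j := by
  funext p
  simp [samples, tableOf]

/-- On an accurate table, an agent is played a number of times bounded by the inverse square
of its gap. -/
theorem card_played_mul_sq_le (hT : 2 ≤ T) (hμ : ValidCTR μ) (hv : ValidValues M v)
    (hi : ∀ j, μ j * v j ≤ μ i * v i) {σ : Realization k T} (hσ : Accurate μ σ) (j : Fin k) :
    (#{t : Fin T | agentOf k (schedule T v (tableOf σ) t) = j} : ℝ) *
      (μ i * v i - μ j * v j) ^ 2 ≤ 128 * M ^ 2 * Real.log T := by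
  classical
  set S : Finset (Fin T) := {t : Fin T | agentOf k (schedule T v (tableOf σ) t) = j} with hS
  have hM : 0 < M := (hv i).1.trans_le (hv i).2
  have hlog := one_half_le_log hT
  have hΔ0 : 0 ≤ μ i * v i - μ j * v j := sub_nonneg.2 (hi j)
  have hΔM : μ i * v i - μ j * v j ≤ M := gap_le hμ hv j
  have hsmall : (#S : ℝ) ≤ 1 → (#S : ℝ) * (μ i * v i - μ j * v j) ^ 2 ≤
      128 * M ^ 2 * Real.log T := by
    intro h
    have h1 : (μ i * v i - μ j * v j) ^ 2 ≤ M ^ 2 := pow_le_pow_left₀ hΔ0 hΔM 2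
    have h2 : (#S : ℝ) * (μ i * v i - μ j * v j) ^ 2 ≤ 1 * M ^ 2 :=
      mul_le_mul h h1 (sq_nonneg _) zero_le_one
    nlinarith [sq_nonneg M]
  rcases S.eq_empty_or_nonempty with hne | hne
  · exact hsmall (by simp [hne])
  obtain ⟨t, ht, hmax⟩ := exists_max_image S (fun t => schedule T v (tableOf σ) t / k) hne
  set P := schedule T v (tableOf σ) t / k with hP
  have hcard : #S ≤ P + 1 := by
    rw [← card_range (P + 1)]
    refine card_le_card_of_injOn (fun t => schedule T v (tableOf σ) t / k)
      (fun r hr => ?_) fun r hr q hq h => ?_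
    · rw [mem_coe, mem_range]
      exact Nat.lt_succ_of_le (hmax r hr)
    · have hr : agentOf k (schedule T v (tableOf σ) r) = j := by simpa [hS] using hr
      have hq : agentOf k (schedule T v (tableOf σ) q) = j := by simpa [hS] using hq
      refine Fin.ext (schedule_injective T v (tableOf σ) ?_)
      rw [← slot_agentOf (k := k) (schedule T v (tableOf σ) r),
        ← slot_agentOf (k := k) (schedule T v (tableOf σ) q), hr, hq]
      exact congrArg (slot j) h
  have hPT : P < T := (schedule_div_le (t : ℕ)).trans_lt t.2
  rcases Nat.eq_zero_or_pos P with hP0 | hP0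
  · refine hsmall ?_
    rw [hP0] at hcard
    exact_mod_cast hcard
  have hact : j ∈ active T v (tableOf σ) P := by
    have h1 := used_schedule (T := T) (b := v) (τ := tableOf σ) t
    rwa [Used, (mem_filter.1 ht).2] at h1
  have hacc : ∀ q ≤ T, ∀ l, (bounds T (samples (tableOf σ) l) q).1 ≤ μ l ∧
      μ l ≤ (bounds T (samples (tableOf σ) l) q).2 ∧
      (0 < q → μ l - 2 * radius T q ≤ (bounds T (samples (tableOf σ) l) q).1 ∧
        (bounds T (samples (tableOf σ) l) q).2 ≤ μ l + 2 * radius T q) := by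
    intro q hq l
    refine bounds_accurate (hμ l).1 (hμ l).2 fun m hm hmq => ?_
    rw [samples_tableOf]
    exact hσ l m hm (hmq.trans hq)
  obtain ⟨Q, hQ⟩ : ∃ Q, P = Q + 1 := ⟨P - 1, by omega⟩
  have hbest : i ∈ active T v (tableOf σ) Q := by
    refine mem_survivors_of_best hi fun q hq l => ?_
    obtain ⟨h1, h2, -⟩ := hacc q (by omega) l
    rw [abs_of_pos (hv l).1, mul_comm (μ l)]
    exact ⟨mul_le_mul_of_nonneg_left h1 (hv l).1.le, mul_le_mul_of_nonneg_left h2 (hv l).1.le⟩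
  rw [hQ] at hact
  have hcmp := (mem_survivors_succ.1 hact).2 i hbest
  rw [← hQ, abs_of_pos (hv i).1, abs_of_pos (hv j).1] at hcmp
  have hri := ((hacc P hPT.le i).2.2 hP0).1
  have hrj := ((hacc P hPT.le j).2.2 hP0).2
  have hr := radius_nonneg T P
  have hΔ : μ i * v i - μ j * v j ≤ 4 * M * radius T P := by
    have h1 := mul_le_mul_of_nonneg_left hri (hv i).1.le
    have h2 := mul_le_mul_of_nonneg_left hrj (hv j).1.le
    have h3 := mul_le_mul_of_nonneg_right (hv i).2 hr
    have h4 := mul_le_mul_of_nonneg_right (hv j).2 hr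
    linarith
  have hPr : P * radius T P ^ 2 = 4 * Real.log T := by
    have : (0 : ℝ) < P := by exact_mod_cast hP0
    rw [radius, Real.sq_sqrt (by positivity)]
    field_simp
  have hcard' : (#S : ℝ) ≤ 2 * P := by
    have : #S ≤ 2 * P := by omega
    exact_mod_cast this
  calc (#S : ℝ) * (μ i * v i - μ j * v j) ^ 2 ≤ 2 * P * (4 * M * radius T P) ^ 2 := by gcongr
    _ = 32 * M ^ 2 * (P * radius T P ^ 2) := by ring
    _ = 128 * M ^ 2 * Real.log T := by rw [hPr]; ring

/-- The regret is bounded by its bound on accurate tables, up to a constant. -/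
theorem regret_eliminationRule_le (hT : 2 ≤ T) (hkT : k ≤ T) (hμ : ValidCTR μ)
    (hv : ValidValues M v) (hi : ∀ j, μ j * v j ≤ μ i * v i) {B : ℝ} (hB : 0 ≤ B)
    (h : ∀ N : Fin k → ℝ, (∀ j, 0 ≤ N j) → ∑ j, N j = T →
      (∀ j, N j * (μ i * v i - μ j * v j) ^ 2 ≤ 128 * M ^ 2 * Real.log T) →
      ∑ j, N j * (μ i * v i - μ j * v j) ≤ B) :
    regret (eliminationRule k T) μ v ≤ B + 2 * M := by
  classical
  have hM : 0 < M := (hv i).1.trans_le (hv i).2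
  have hT0 : (0 : ℝ) < T := by positivity
  rw [regret_eq_sum_prob _ hi, sum_prob_eliminationRule μ v fun a _ =>
    ∑ t, (μ i * v i - μ (a t) * v (a t))]
  have key : ∀ σ : Realization k T, ∑ t : Fin T, (μ i * v i -
      μ (agentOf k (schedule T v (tableOf σ) t)) * v (agentOf k (schedule T v (tableOf σ) t))) ≤
      B + (T * M) * (if Accurate μ σ then 0 else 1) := by
    intro σ
    split_ifs with hσ
    · rw [mul_zero, add_zero]
      refine le_trans (le_of_eq ?_) (h (fun j =>
        (#{t : Fin T | agentOf k (schedule T v (tableOf σ) t) = j} : ℝ))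
        (fun j => Nat.cast_nonneg _) ?_ (card_played_mul_sq_le hT hμ hv hi hσ))
      · rw [← sum_fiberwise univ fun t : Fin T => agentOf k (schedule T v (tableOf σ) t)]
        refine sum_congr rfl fun j _ => ?_
        rw [sum_congr rfl fun t ht => by rw [(mem_filter.1 ht).2], sum_const, nsmul_eq_mul]
      · rw [← Nat.cast_sum, ← card_eq_sum_card_fiberwise (fun _ _ => by simp)]
        simp
    · have := sum_le_sum fun t (_ : t ∈ univ) =>
        gap_le (i := i) hμ hv (agentOf k (schedule T v (tableOf σ) (t : Fin T)))
      simp only [sum_const, card_univ, Fintype.card_fin, nsmul_eq_mul] at this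
      linarith
  calc _ ≤ ∑ σ : Realization k T, (prob μ σ * B +
        (T * M) * (prob μ σ * (if Accurate μ σ then 0 else 1))) := by
        refine sum_le_sum fun σ _ => ?_
        refine (mul_le_mul_of_nonneg_left (key σ) (prob_nonneg hμ σ)).trans (le_of_eq ?_)
        ring
    _ ≤ B + (T * M) * (2 * k / (T : ℝ) ^ 2) := by
        rw [sum_add_distrib, ← sum_mul, sum_prob, one_mul, ← mul_sum]
        have := sum_prob_not_accurate (T := T) hμ hT
        gcongr
    _ ≤ B + 2 * M := by
        have hkT' : (k : ℝ) ≤ T := by exact_mod_cast hkT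
        have : (T * M) * (2 * k / (T : ℝ) ^ 2) = 2 * M * (k / T) := by field_simp
        rw [this]
        have : (k : ℝ) / T ≤ 1 := (div_le_one hT0).2 hkT'
        nlinarith

theorem regret_eliminationRule_le_sqrt (hk : 2 ≤ k) (hT : 2 ≤ T) (hμ : ValidCTR μ)
    (hv : ValidValues M v) :
    regret (eliminationRule k T) μ v ≤ 200 * M * Real.sqrt (k * T * Real.log T) := by
  obtain ⟨i, hi⟩ := Finite.exists_max fun j => μ j * v j
  have hM : 0 < M := (hv i).1.trans_le (hv i).2
  have hlog := one_half_le_log hT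
  have hT' : (2 : ℝ) ≤ T := by exact_mod_cast hT
  have hk' : (2 : ℝ) ≤ k := by exact_mod_cast hk
  rcases le_total k T with hkT | hkT
  · set R := Real.sqrt (k * T * Real.log T) with hR
    have hR1 : 1 ≤ R := by
      rw [hR, Real.one_le_sqrt]
      nlinarith [mul_le_mul hk' hT' zero_le_two (by linarith)]
    have hR2 : R ^ 2 = k * T * Real.log T := Real.sq_sqrt (by positivity)
    refine (regret_eliminationRule_le (B := 12 * M * R) hT hkT hμ hv hi (by positivity)
      fun N hN hsum hsq => ?_).trans (by nlinarith)
    refine abs_le_of_sq_le_sq' ?_ (by positivity) |>.2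
    calc (∑ j, N j * (μ i * v i - μ j * v j)) ^ 2
        ≤ k * ∑ j, (N j * (μ i * v i - μ j * v j)) ^ 2 := by
          simpa using sq_sum_le_card_mul_sum_sq (s := univ)
            (f := fun j => N j * (μ i * v i - μ j * v j))
      _ ≤ k * ∑ j, N j * (128 * M ^ 2 * Real.log T) := by
          gcongr with j
          have := mul_le_mul_of_nonneg_left (hsq j) (hN j)
          linarith
      _ = 128 * M ^ 2 * R ^ 2 := by
          rw [← sum_mul, hsum, hR2]
          ring
      _ ≤ (12 * M * R) ^ 2 := by nlinarith [sq_nonneg (M * R)]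
  · refine (regret_le_horizon_mul _ hμ hv hi).trans ?_
    have hkT' : (T : ℝ) ≤ k := by exact_mod_cast hkT
    have : (T : ℝ) / 2 ≤ Real.sqrt (k * T * Real.log T) := by
      refine Real.le_sqrt_of_sq_le ?_
      have h1 : (T : ℝ) * T ≤ k * T := by gcongr
      have h2 : (k : ℝ) * T * (1 / 2) ≤ k * T * Real.log T := by gcongr
      nlinarith
    nlinarith

theorem regret_eliminationRule_le_gap {vmax δ : ℝ} (hk : 2 ≤ k) (hT : 2 ≤ T) (hδ : 0 < δ)
    (hμ : ValidCTR μ) (hv : ValidValues vmax v) (hgap : HasGap μ v δ) :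
    regret (eliminationRule k T) μ v ≤ 200 * vmax * (k / δ) * Real.log T := by
  obtain ⟨i, hi, hgap⟩ := hgap
  set M := ⨆ j, v j with hMdef
  have hvM : ValidValues M v := fun j =>
    ⟨(hv j).1, le_ciSup (f := v) (Set.finite_range _).bddAbove j⟩
  have hM : 0 < M := (hvM i).1.trans_le (hvM i).2
  have hMv : M ≤ vmax := ciSup_le fun j => (hv j).2
  have hlog := one_half_le_log hT
  have hk' : (2 : ℝ) ≤ k := by exact_mod_cast hk
  have hΔ : ∀ j, j ≠ i → δ * M ≤ μ i * v i - μ j * v j := by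
    intro j hj
    have := le_ciSup (f := fun j : {j : Fin k // j ≠ i} => μ j.1 * v j.1)
      (Set.finite_range _).bddAbove ⟨j, hj⟩
    simp only at this
    linarith
  have hδ1 : δ ≤ 1 := by
    have : Nontrivial (Fin k) := Fin.nontrivial_iff_two_le.2 hk
    obtain ⟨j, hj⟩ := exists_ne i
    have h1 := (hΔ j hj).trans (gap_le hμ hvM j)
    nlinarith
  have hkδ : (k : ℝ) ≤ k / δ := by
    rw [le_div_iff₀ hδ]
    nlinarith
  have hX : k / 2 ≤ k / δ * Real.log T := by nlinarith
  suffices h : regret (eliminationRule k T) μ v ≤ 200 * M * (k / δ * Real.log T) by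
    refine h.trans ?_
    rw [mul_assoc (200 * vmax)]
    gcongr
  rcases le_total k T with hkT | hkT
  · refine (regret_eliminationRule_le (B := 128 * M * (k / δ * Real.log T)) hT hkT hμ hvM hi
      (by positivity) fun N hN hsum hsq => ?_).trans (by nlinarith)
    calc ∑ j, N j * (μ i * v i - μ j * v j) ≤ ∑ _j : Fin k, 128 * M * Real.log T / δ := by
          refine sum_le_sum fun j _ => ?_
          rcases eq_or_ne j i with rfl | hj
          · rw [sub_self, mul_zero]
            positivity
          · rw [le_div_iff₀ hδ]
            have h1 := mul_le_mul_of_nonneg_left (hΔ j hj)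
              (mul_nonneg (hN j) (sub_nonneg.2 (hi j)))
            have h2 := hsq j
            refine le_of_mul_le_mul_right ?_ hM
            nlinarith
      _ = _ := by
          simp
          ring
  · refine (regret_le_horizon_mul _ hμ hvM hi).trans ?_
    have hkT' : (T : ℝ) ≤ k := by exact_mod_cast hkT
    nlinarith

end Regret

theorem sum_prob_mul_clicks_eliminationRule_mono [NeZero k] {μ b b' : Fin k → ℝ}
    (hμ : ValidCTR μ) {i : Fin k} (hi : |b i| ≤ |b' i|) (hne : ∀ j, j ≠ i → b' j = b j) :
    ∑ ρ, prob μ ρ * (clicks (eliminationRule k T) b ρ i : ℝ) ≤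
      ∑ ρ, prob μ ρ * (clicks (eliminationRule k T) b' ρ i : ℝ) := by
  have h : ∀ (c : Fin k → ℝ) (ρ : Realization k T), (clicks (eliminationRule k T) c ρ i : ℝ) =
      (fun (a : Fin T → Fin k) (x : Fin T → Bool) => (#{t | a t = i ∧ x t = true} : ℝ))
        (eliminationRule k T c ρ) fun t => ρ (eliminationRule k T c ρ t) t := by
    intro c ρ
    simp only [clicks, Nat.cast_inj]
    exact congrArg card (filter_congr fun t _ => and_congr_right fun e => by rw [e])
  simp only [h]
  rw [sum_prob_eliminationRule μ b fun (a : Fin T → Fin k) (x : Fin T → Bool) =>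
      (#{t | a t = i ∧ x t = true} : ℝ),
    sum_prob_eliminationRule μ b' fun (a : Fin T → Fin k) (x : Fin T → Bool) =>
      (#{t | a t = i ∧ x t = true} : ℝ)]
  exact sum_le_sum fun σ _ => mul_le_mul_of_nonneg_left
    (Nat.cast_le.2 (clicks_table_mono hi hne)) (prob_nonneg hμ σ)

/-- There is a deterministic allocation rule, monotone in expectation,
with worst-case regret `O(vmax · √(k T log T))` and regret `O(vmax · (k/δ) · log T)`
on every `δ`-gap instance. -/
theorem monotone_in_expectation_optimal_regret :
    ∃ C : ℝ, 0 < C ∧ ∀ k T : ℕ, 2 ≤ k → 2 ≤ T →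
      ∃ A : Alloc k T, Online A ∧
        -- monotone in expectation
        (∀ μ : Fin k → ℝ, ValidCTR μ → ∀ (i : Fin k) (b : Fin k → ℝ), PosBids b →
          ∀ x y : ℝ, 0 < x → x ≤ y →
            (∑ ρ : Realization k T,
                prob μ ρ * (clicks A (Function.update b i x) ρ i : ℝ)) ≤
            (∑ ρ : Realization k T,
                prob μ ρ * (clicks A (Function.update b i y) ρ i : ℝ))) ∧
        -- worst-case regret
        (∀ vmax : ℝ, 0 < vmax →
          worstRegret A vmax ≤ C * vmax * Real.sqrt ((k : ℝ) * T * Real.log T)) ∧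
        -- regret on δ-gap instances
        (∀ vmax δ : ℝ, 0 < vmax → 0 < δ →
          ∀ μ v : Fin k → ℝ, ValidCTR μ → ValidValues vmax v → HasGap μ v δ →
            regret A μ v ≤ C * vmax * ((k : ℝ) / δ) * Real.log T) := by
  refine ⟨200, by norm_num, fun k T hk hT => ?_⟩
  have : NeZero k := ⟨by omega⟩
  refine ⟨eliminationRule k T, online_eliminationRule, fun μ hμ i b _ x y hx hxy => ?_,
    fun vmax hvmax => ?_, fun vmax δ _ hδ μ v hμ hv hgap =>
      regret_eliminationRule_le_gap hk hT hδ hμ hv hgap⟩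
  · refine sum_prob_mul_clicks_eliminationRule_mono hμ ?_ fun j hj => by simp [hj]
    simpa [abs_of_pos hx, abs_of_pos (hx.trans_le hxy)] using hxy
  · refine Real.sSup_le ?_ (by positivity)
    rintro r ⟨μ, v, hμ, hv, rfl⟩
    exact regret_eliminationRule_le_sqrt hk hT hμ hv

end MAB
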